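/- arXiv:2203.03775 — 6 statements merged into one kernel-verified Lean document; each statement's English description precedes it below -/
import Mathlib

section
/- Let β1, β2, γ1, γ2 be integers with ε := β1·γ2 − β2·γ1 ∈ {−1, 1}, and let k ∈ ℝ. Then there exists t ∈ ℝ such that 1 + e^{i(β1 k + γ1 t)} + e^{i(β2 k + γ2 t)} = 0 if and only if there exist σ ∈ {−1, 1} and an integer ℓ such that k = σ·(2π/3)·(γ1 + γ2)·ε + 2πℓ. -/
open Real

theorem one_add_exp_add_exp_eq_zero_iff_cos_sin (a b : ℝ) :
    1 + Complex.exp (Complex.I * a) + Complex.exp (Complex.I * b) = 0 ↔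
      1 + cos a + cos b = 0 ∧ sin a + sin b = 0 := by
  rw [mul_comm _ (a : ℂ), mul_comm _ (b : ℂ), Complex.ext_iff]
  simp [Complex.exp_ofReal_mul_I_re, Complex.exp_ofReal_mul_I_im]

theorem cos_two_pi_div_three : cos (2 * π / 3) = -1 / 2 := by
  rw [show 2 * π / 3 = π - π / 3 by ring, cos_pi_sub, cos_pi_div_three]
  norm_num

/-- Three unit complex numbers `1, e^{ia}, e^{ib}` sum to zero exactly when they form an
equilateral triangle. -/
theorem one_add_exp_add_exp_eq_zero_iff (a b : ℝ) :
    1 + Complex.exp (Complex.I * a) + Complex.exp (Complex.I * b) = 0 ↔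
      ∃ σ : ℝ, (σ = 1 ∨ σ = -1) ∧ ∃ m n : ℤ,
        a = σ * (2 * π / 3) + 2 * π * m ∧ b = -(σ * (2 * π / 3)) + 2 * π * n := by
  rw [one_add_exp_add_exp_eq_zero_iff_cos_sin]
  constructor
  · rintro ⟨hcos, hsin⟩
    have hsinb : sin b = -sin a := by linarith
    have hcosb : cos b = -1 - cos a := by linarith
    have hb := sin_sq_add_cos_sq b
    rw [hsinb, hcosb] at hb
    have ha := sin_sq_add_cos_sq a
    have hcosa : cos a = -1 / 2 := by linarith
    have hadd : cos (a + b) = 1 := by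
      rw [cos_add, hsinb, hcosb]
      linear_combination ha - 2 * cos a * hcosa
    obtain ⟨n, hn⟩ := (cos_eq_one_iff _).1 hadd
    obtain ⟨m, hm | hm⟩ := cos_eq_cos_iff.1 (cos_two_pi_div_three.trans hcosa.symm)
    · refine ⟨1, Or.inl rfl, m, n - m, ?_, ?_⟩ <;> push_cast <;> linarith
    · refine ⟨-1, Or.inr rfl, m, n - m, ?_, ?_⟩ <;> push_cast <;> linarith
  · rintro ⟨σ, hσ, m, n, rfl, rfl⟩
    rw [mul_comm (2 * π) (m : ℝ), mul_comm (2 * π) (n : ℝ)]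
    simp only [cos_add_int_mul_two_pi, sin_add_int_mul_two_pi, cos_neg, sin_neg]
    have hcos : cos (σ * (2 * π / 3)) = -1 / 2 := by
      rcases hσ with rfl | rfl <;> simp [cos_two_pi_div_three]
    constructor <;> linarith

/-- Characterization of the quasimomenta `k` at which the three unit
complex numbers `1, e^{i(β1 k + γ1 t)}, e^{i(β2 k + γ2 t)}` can sum to
zero: this occurs for some `t ∈ ℝ` if and only if
`k = σ·(2π/3)·(γ1 + γ2)·(β1 γ2 − β2 γ1) + 2πℓ` for some `σ = ±1` and some
integer `ℓ`. -/
theorem zero_in_essential_spectrum_iff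
    (β1 β2 γ1 γ2 : ℤ)
    (hdet : β1 * γ2 - β2 * γ1 = 1 ∨ β1 * γ2 - β2 * γ1 = -1)
    (k : ℝ) :
    (∃ t : ℝ,
        1 + Complex.exp (Complex.I * (β1 * k + γ1 * t)) +
          Complex.exp (Complex.I * (β2 * k + γ2 * t)) = 0) ↔
      (∃ σ : ℝ, (σ = 1 ∨ σ = -1) ∧ ∃ ℓ : ℤ,
        k = σ * (2 * π / 3) * ((γ1 + γ2 : ℤ) : ℝ) * ((β1 * γ2 - β2 * γ1 : ℤ) : ℝ)
          + 2 * π * ℓ) := by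
  have hε : ((β1 : ℝ) * γ2 - β2 * γ1) ^ 2 = 1 := by
    have h : (β1 * γ2 - β2 * γ1) ^ 2 = 1 := by rcases hdet with h | h <;> rw [h] <;> norm_num
    exact_mod_cast h
  have key (t : ℝ) := one_add_exp_add_exp_eq_zero_iff (β1 * k + γ1 * t) (β2 * k + γ2 * t)
  push_cast at key ⊢
  simp only [key]
  constructor
  · rintro ⟨t, σ, hσ, m, n, h1, h2⟩
    refine ⟨σ, hσ, (β1 * γ2 - β2 * γ1) * (γ2 * m - γ1 * n), ?_⟩
    push_cast
    linear_combination (β1 * γ2 - β2 * γ1 : ℝ) * (γ2 * h1 - γ1 * h2) - k * hε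
  · rintro ⟨σ, hσ, ℓ, hk⟩
    refine ⟨-((β1 * γ2 - β2 * γ1) * σ * (2 * π / 3) * (β1 + β2)), σ, hσ, β1 * ℓ, β2 * ℓ, ?_, ?_⟩
    · push_cast
      linear_combination β1 * hk + σ * (2 * π / 3) * hε
    · push_cast
      linear_combination β2 * hk - σ * (2 * π / 3) * hε
end

section
/- Let β1, β2, γ1, γ2 be integers with 0 < γ1 < γ2, and let k ∈ ℝ. Then the polynomial P(ζ) = 1 + e^{i β1 k} ζ^{γ1} + e^{i β2 k} ζ^{γ2} has no multiple roots: there is no ζ ∈ ℂ with P(ζ) = 0 and P′(ζ) = 0, where P′(ζ) = γ1·e^{i β1 k} ζ^{γ1 − 1} + γ2·e^{i β2 k} ζ^{γ2 − 1}. -/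
open Real

lemma norm_exp_I_mul_intCast_mul (β : ℤ) (k : ℝ) :
    ‖Complex.exp (Complex.I * β * k)‖ = 1 := by
  simp [Complex.norm_exp]

/-- The honeycomb edge polynomial
`P(ζ) = 1 + e^{i β1 k} ζ^{γ1} + e^{i β2 k} ζ^{γ2}` (with `0 < γ1 < γ2`)
has no multiple roots: no `ζ ∈ ℂ` satisfies both `P(ζ) = 0` and
`P′(ζ) = 0`. -/
theorem honeycomb_edge_polynomial_no_multiple_roots
    (β1 β2 γ1 γ2 : ℤ) (hγ1 : 0 < γ1) (hγ12 : γ1 < γ2) (k : ℝ) :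
    ¬ ∃ ζ : ℂ,
      (1 + Complex.exp (Complex.I * β1 * k) * ζ ^ γ1 +
        Complex.exp (Complex.I * β2 * k) * ζ ^ γ2 = 0) ∧
      ((γ1 : ℂ) * Complex.exp (Complex.I * β1 * k) * ζ ^ (γ1 - 1) +
        (γ2 : ℂ) * Complex.exp (Complex.I * β2 * k) * ζ ^ (γ2 - 1) = 0) := by
  rintro ⟨ζ, hP, hP'⟩
  have hζ : ζ ≠ 0 := by
    rintro rfl
    simp [zero_zpow _ hγ1.ne', zero_zpow _ (hγ1.trans hγ12).ne'] at hP
  set a := Complex.exp (Complex.I * β1 * k)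
  set b := Complex.exp (Complex.I * β2 * k)
  have ha1 : ‖a‖ = 1 := norm_exp_I_mul_intCast_mul β1 k
  have hb1 : ‖b‖ = 1 := norm_exp_I_mul_intCast_mul β2 k
  have hE : (γ1 : ℂ) * a * ζ ^ γ1 + γ2 * b * ζ ^ γ2 = 0 := by
    have h1 : ζ ^ γ1 = ζ ^ (γ1 - 1) * ζ := by rw [← zpow_add_one₀ hζ, sub_add_cancel]
    have h2 : ζ ^ γ2 = ζ ^ (γ2 - 1) * ζ := by rw [← zpow_add_one₀ hζ, sub_add_cancel]
    rw [h1, h2]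
    linear_combination ζ * hP'
  have hA : ((γ2 - γ1 : ℤ) : ℂ) * (a * ζ ^ γ1) = -(γ2 : ℂ) := by
    push_cast
    linear_combination γ2 * hP - hE
  have hB : ((γ2 - γ1 : ℤ) : ℂ) * (b * ζ ^ γ2) = γ1 := by
    push_cast
    linear_combination hE - γ1 * hP
  have h1 : (0 : ℝ) < γ1 := by exact_mod_cast hγ1
  have h12 : (γ1 : ℝ) < γ2 := by exact_mod_cast hγ12
  have hd : (0 : ℝ) < γ2 - γ1 := sub_pos.mpr h12
  have hA' : ((γ2 : ℝ) - γ1) * ‖ζ‖ ^ γ1 = γ2 := by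
    have h := congrArg norm hA
    rw [norm_mul, norm_mul, ha1, norm_neg, Complex.norm_intCast, Complex.norm_intCast,
      norm_zpow, one_mul, abs_of_pos (h1.trans h12)] at h
    push_cast at h
    rwa [abs_of_pos hd] at h
  have hB' : ((γ2 : ℝ) - γ1) * ‖ζ‖ ^ γ2 = γ1 := by
    have h := congrArg norm hB
    rw [norm_mul, norm_mul, hb1, Complex.norm_intCast, Complex.norm_intCast,
      norm_zpow, one_mul, abs_of_pos h1] at h
    push_cast at h
    rwa [abs_of_pos hd] at h
  rcases le_total 1 ‖ζ‖ with hr | hr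
  · nlinarith [zpow_le_zpow_right₀ hr hγ12.le]
  · nlinarith [zpow_le_one₀ (norm_pos_iff.mpr hζ) hr hγ1.le]
end

section
/- For every κ ∈ (0, 1), the function M is strictly decreasing on [ρc, 1]: if ρc ≤ ρ < ρ' ≤ 1 then M(ρ') < M(ρ). -/
open Real

/-- Derivative of the exterior angle opposite to the side of length `b` in a triangle with sides
`1`, `a x`, `b x`, where `D` is sixteen times the squared area. -/
lemma hasDerivAt_exteriorAngle {a b : ℝ → ℝ} {a' b' x D : ℝ} (ha : HasDerivAt a a' x)
    (hb : HasDerivAt b b' x) (ha0 : 0 < a x) (hD : 0 < D)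
    (hDdef : D = (2 * a x) ^ 2 - (b x ^ 2 - a x ^ 2 - 1) ^ 2) :
    HasDerivAt (fun y => arccos ((b y ^ 2 - a y ^ 2 - 1) / (2 * a y)))
      (-(2 * b x * b' - (b x ^ 2 + a x ^ 2 - 1) * a' / a x) / √D) x := by
  have h1u : 1 - ((b x ^ 2 - a x ^ 2 - 1) / (2 * a x)) ^ 2 = D / (2 * a x) ^ 2 := by
    rw [hDdef]; field_simp
  have hu : 0 < 1 - ((b x ^ 2 - a x ^ 2 - 1) / (2 * a x)) ^ 2 := by rw [h1u]; positivity
  have hsqrt : √(1 - ((b x ^ 2 - a x ^ 2 - 1) / (2 * a x)) ^ 2) = √D / (2 * a x) := by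
    rw [h1u, sqrt_div hD.le, sqrt_sq (by positivity)]
  have hq : HasDerivAt (fun y => (b y ^ 2 - a y ^ 2 - 1) / (2 * a y))
      ((2 * b x * b' - (b x ^ 2 + a x ^ 2 - 1) * a' / a x) / (2 * a x)) x := by
    refine ((((hb.fun_pow 2).fun_sub (ha.fun_pow 2)).sub_const 1).fun_div (ha.const_mul 2)
      (by positivity)).congr_deriv ?_
    field_simp
    push_cast
    ring
  have := (hasDerivAt_arccos (x := (b x ^ 2 - a x ^ 2 - 1) / (2 * a x))
    (by rintro h; rw [h] at hu; norm_num at hu)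
    (by rintro h; rw [h] at hu; norm_num at hu)).comp x hq
  refine this.congr_deriv ?_
  rw [hsqrt]
  have := sqrt_pos.2 hD
  field_simp

/-- In a triangle with sides `1`, `a`, `x`, where `a` varies with `x` like `x ^ κ`, the weighted sum
of the exterior angles opposite to `x` and `a` has negative derivative. -/
lemma hasDerivAt_exteriorAngles_neg {κ x s : ℝ} {a : ℝ → ℝ} (hκ : κ ∈ Set.Ioo (0 : ℝ) 1)
    (hx0 : 0 < x) (hx1 : x < 1) (ha0 : 0 < s) (ha1 : s < 1) (hsum : 1 < s + x)
    (ha : HasDerivAt a (κ * s / x) x) (hs : a x = s) :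
    ∃ m < 0, HasDerivAt (fun y => arccos ((y ^ 2 - a y ^ 2 - 1) / (2 * a y)) +
      κ * arccos ((a y ^ 2 - y ^ 2 - 1) / (2 * y))) m x := by
  subst hs
  obtain ⟨hκ0, hκ1⟩ := hκ
  have hD : 0 < (2 * a x) ^ 2 - (x ^ 2 - a x ^ 2 - 1) ^ 2 := by
    have h : 0 < ((a x + 1 - x) * (a x + 1 + x)) * ((x + a x - 1) * (x + 1 - a x)) :=
      mul_pos (mul_pos (by linarith) (by linarith)) (mul_pos (by linarith) (by linarith))
    linarith
  refine ⟨_, ?_, (hasDerivAt_exteriorAngle ha (hasDerivAt_id x) ha0 hD rfl).add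
    ((hasDerivAt_exteriorAngle (hasDerivAt_id x) ha hx0 hD (by simp only [id]; ring)).const_mul κ)⟩
  have hS := sqrt_pos.2 hD
  have hpos : 0 < (1 - κ) * x ^ 2 + κ * (1 - (1 - κ) * a x ^ 2) := by
    have : (1 - κ) * a x ^ 2 < 1 := by nlinarith
    have := mul_pos hκ0 (sub_pos.2 this)
    have := mul_pos (sub_pos.2 hκ1) (pow_pos hx0 2)
    linarith
  calc _ = -(2 * ((1 - κ) * x ^ 2 + κ * (1 - (1 - κ) * a x ^ 2)) /
        (x * √((2 * a x) ^ 2 - (x ^ 2 - a x ^ 2 - 1) ^ 2))) := by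
        simp only [id]
        field_simp
        ring
    _ < 0 := by
        rw [neg_lt_zero]
        positivity

/-- Monotonicity Lemma: for `κ ∈ (0,1)` and `ρc ∈ (0,1)` with
`ρc^κ + ρc = 1`, the function
`M(ρ) = arccos((ρ² − ρ^{2κ} − 1)/(2ρ^κ)) + κ·arccos((ρ^{2κ} − ρ² − 1)/(2ρ))`
is strictly decreasing on `[ρc, 1]`. -/
theorem monotonicity_lemma
    (κ : ℝ) (hκ : κ ∈ Set.Ioo (0 : ℝ) 1)
    (ρc : ℝ) (hρc : ρc ∈ Set.Ioo (0 : ℝ) 1) (hρcdef : ρc ^ κ + ρc = 1) :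
    ∀ ρ ρ' : ℝ, ρc ≤ ρ → ρ < ρ' → ρ' ≤ 1 →
      Real.arccos ((ρ' ^ 2 - ρ' ^ (2 * κ) - 1) / (2 * ρ' ^ κ)) +
          κ * Real.arccos ((ρ' ^ (2 * κ) - ρ' ^ 2 - 1) / (2 * ρ')) <
        Real.arccos ((ρ ^ 2 - ρ ^ (2 * κ) - 1) / (2 * ρ ^ κ)) +
          κ * Real.arccos ((ρ ^ (2 * κ) - ρ ^ 2 - 1) / (2 * ρ)) := by
  intro ρ ρ' h1 h2 h3
  have hρ : 0 < ρ := hρc.1.trans_le h1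
  have hsq : ∀ x : ℝ, 0 < x → x ^ (2 * κ) = (x ^ κ) ^ 2 := fun x hx => by
    rw [mul_comm, rpow_mul hx.le, rpow_two]
  rw [hsq ρ hρ, hsq ρ' (hρ.trans h2)]
  have hanti : StrictAntiOn (fun x : ℝ => arccos ((x ^ 2 - (x ^ κ) ^ 2 - 1) / (2 * x ^ κ)) +
      κ * arccos (((x ^ κ) ^ 2 - x ^ 2 - 1) / (2 * x))) (Set.Icc ρc 1) := by
    have hpos : ∀ x ∈ Set.Icc ρc 1, 0 < x := fun x hx => hρc.1.trans_le hx.1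
    refine strictAntiOn_of_deriv_neg (convex_Icc _ _) ?_ fun x hx => ?_
    · have hpow : ContinuousOn (fun x : ℝ => x ^ κ) (Set.Icc ρc 1) :=
        continuousOn_id.rpow_const fun x _ => Or.inr hκ.1.le
      refine (continuous_arccos.comp_continuousOn (ContinuousOn.div (by fun_prop) (by fun_prop)
        fun x hx => ?_)).add (continuousOn_const.mul (continuous_arccos.comp_continuousOn
          (ContinuousOn.div (by fun_prop) (by fun_prop) fun x hx => ?_)))
      · exact (mul_pos two_pos (rpow_pos_of_pos (hpos x hx) κ)).ne'
      · exact (mul_pos two_pos (hpos x hx)).ne'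
    · rw [interior_Icc] at hx
      have hx0 : 0 < x := hρc.1.trans hx.1
      have hlt : ρc ^ κ < x ^ κ := rpow_lt_rpow hρc.1.le hx.1 hκ.1
      have hx1 : x ^ κ < 1 := rpow_lt_one hx0.le hx.2 hκ.1
      have hd : HasDerivAt (fun y : ℝ => y ^ κ) (κ * x ^ κ / x) x := by
        refine (hasDerivAt_rpow_const (p := κ) (Or.inl hx0.ne')).congr_deriv ?_
        rw [rpow_sub_one hx0.ne', mul_div_assoc]
      obtain ⟨m, hm, hderiv⟩ := hasDerivAt_exteriorAngles_neg hκ hx0 hx.2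
        (rpow_pos_of_pos hx0 κ) hx1 (by linarith [hx.1]) hd rfl
      rwa [hderiv.deriv]
  exact hanti ⟨h1, h2.le.trans h3⟩ ⟨h1.trans h2.le, h3⟩ h2
end

section
/- For every κ ∈ (0, 1) and every ρ with ρc < ρ < 1, one has r(ρ) > 0 and M is differentiable at ρ with derivative M′(ρ) = (2/ρ)·(1/√(r(ρ)))·( κ·((1 − κ)·ρ^{2κ} − 1) + (κ − 1)·ρ² ), where r(ρ) = 2(1 + ρ²)·ρ^{2κ} − ρ^{4κ} − (1 − ρ²)². -/
open Real

/-- The Heron product of a triangle with sides `1`, `a`, `b` is positive. -/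
lemma heron_pos {a b : ℝ} (ha : 0 < a) (hb : 0 < b) (ha1 : a < 1) (hb1 : b < 1)
    (hab : 1 < a + b) : 0 < 2 * (1 + a ^ 2) * b ^ 2 - b ^ 4 - (1 - a ^ 2) ^ 2 := by
  have h1 : 0 < 1 + a + b := by linarith
  have h2 : 0 < 1 + a - b := by linarith
  have h3 : 0 < 1 - a + b := by linarith
  have h4 : 0 < a + b - 1 := by linarith
  calc 0 < (1 + a + b) * (1 + a - b) * (1 - a + b) * (a + b - 1) := by positivity
    _ = _ := by ring

/-- Derivative of the angle, given by the law of cosines, in a triangle with sides `1`, `f`, `g`. -/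
lemma hasDerivAt_arccos_law_cos {f g : ℝ → ℝ} {f' g' x r : ℝ} (hf : HasDerivAt f f' x)
    (hg : HasDerivAt g g' x) (hgx : 0 < g x) (hr : 0 < r)
    (hr_eq : r = 2 * (1 + f x ^ 2) * g x ^ 2 - g x ^ 4 - (1 - f x ^ 2) ^ 2) :
    HasDerivAt (fun y => arccos ((f y ^ 2 - g y ^ 2 - 1) / (2 * g y)))
      (-((2 * f x * f' * g x - (f x ^ 2 + g x ^ 2 - 1) * g') / (g x * √r))) x := by
  have hsq : 1 - ((f x ^ 2 - g x ^ 2 - 1) / (2 * g x)) ^ 2 = r / (2 * g x) ^ 2 := by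
    rw [hr_eq]
    field_simp
    ring
  have hpos : 0 < 1 - ((f x ^ 2 - g x ^ 2 - 1) / (2 * g x)) ^ 2 := by
    rw [hsq]
    positivity
  have hsqrt : √(1 - ((f x ^ 2 - g x ^ 2 - 1) / (2 * g x)) ^ 2) = √r / (2 * g x) := by
    rw [hsq, sqrt_div hr.le, sqrt_sq (by positivity)]
  have hquot := (((hf.fun_pow 2).fun_sub (hg.fun_pow 2)).sub_const 1).fun_div (hg.const_mul 2)
    (by positivity)
  have hcos := (hasDerivAt_arccos (x := (f x ^ 2 - g x ^ 2 - 1) / (2 * g x))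
    (by rintro h; rw [h] at hpos; norm_num at hpos)
    (by rintro h; rw [h] at hpos; norm_num at hpos)).comp x hquot
  refine hcos.congr_deriv ?_
  rw [hsqrt]
  have : √r ≠ 0 := (sqrt_pos.2 hr).ne'
  field_simp
  ring

/-- For `κ ∈ (0,1)`, `ρc ∈ (0,1)` with `ρc^κ + ρc = 1`, and
`ρc < ρ < 1`, one has `r(ρ) > 0` and the function `M` is differentiable
at `ρ` with `M′(ρ) = (2/ρ)·(1/√r(ρ))·(κ((1−κ)ρ^{2κ} − 1) + (κ−1)ρ²)`,
where `r(ρ) = 2(1+ρ²)ρ^{2κ} − ρ^{4κ} − (1−ρ²)²`. -/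
theorem M_has_deriv_at
    (κ : ℝ) (hκ : κ ∈ Set.Ioo (0 : ℝ) 1)
    (ρc : ℝ) (hρc : ρc ∈ Set.Ioo (0 : ℝ) 1) (hρcdef : ρc ^ κ + ρc = 1)
    (ρ : ℝ) (hρ1 : ρc < ρ) (hρ2 : ρ < 1) :
    0 < 2 * (1 + ρ ^ 2) * ρ ^ (2 * κ) - ρ ^ (4 * κ) - (1 - ρ ^ 2) ^ 2 ∧
    HasDerivAt
      (fun x : ℝ =>
        Real.arccos ((x ^ 2 - x ^ (2 * κ) - 1) / (2 * x ^ κ)) +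
          κ * Real.arccos ((x ^ (2 * κ) - x ^ 2 - 1) / (2 * x)))
      ((2 / ρ) *
        (1 / Real.sqrt (2 * (1 + ρ ^ 2) * ρ ^ (2 * κ) - ρ ^ (4 * κ) - (1 - ρ ^ 2) ^ 2)) *
        (κ * ((1 - κ) * ρ ^ (2 * κ) - 1) + (κ - 1) * ρ ^ 2))
      ρ := by
  obtain ⟨hκ0, -⟩ := hκ
  have hρ0 : 0 < ρ := hρc.1.trans hρ1
  have hmul : ∀ {x : ℝ}, 0 < x → x ^ (2 * κ) = (x ^ κ) ^ 2 := fun hx => by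
    rw [mul_comm, rpow_mul hx.le, rpow_two]
  have hfour : ρ ^ (4 * κ) = (ρ ^ κ) ^ 4 := by
    rw [mul_comm, rpow_mul hρ0.le]
    exact_mod_cast rpow_natCast (ρ ^ κ) 4
  have hu0 : 0 < ρ ^ κ := rpow_pos_of_pos hρ0 κ
  have hsum : 1 < ρ + ρ ^ κ := by
    have := rpow_lt_rpow hρc.1.le hρ1 hκ0
    linarith
  have hr := heron_pos hρ0 hu0 hρ2 (rpow_lt_one hρ0.le hρ2 hκ0) hsum
  rw [hfour, hmul hρ0]
  refine ⟨hr, ?_⟩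
  have hu : HasDerivAt (fun x : ℝ => x ^ κ) (κ * ρ ^ κ / ρ) ρ :=
    (hasDerivAt_rpow_const (Or.inl hρ0.ne')).congr_deriv (by
      rw [rpow_sub_one hρ0.ne', mul_div_assoc])
  have hM := (hasDerivAt_arccos_law_cos (hasDerivAt_id' ρ) hu hu0 hr rfl).fun_add
    ((hasDerivAt_arccos_law_cos hu (hasDerivAt_id' ρ) hρ0 hr (by ring)).const_mul κ)
  refine (hM.congr_deriv ?_).congr_of_eventuallyEq ?_
  · have := (sqrt_pos.2 hr).ne'
    field_simp
    ring
  · filter_upwards [lt_mem_nhds hρ0] with x hx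
    rw [hmul hx]
end

section
/- Let r ≥ 1 and let ζ1, …, ζr be pairwise distinct complex numbers. Then there exist complex numbers A1, …, Ar such that for every integer n ≥ 1, the sum over all r-tuples (k1, …, kr) of integers with each ki ≥ 1 and k1 + ⋯ + kr = n of the products ζ1^{k1}·ζ2^{k2}·⋯·ζr^{kr} equals A1·ζ1^n + ⋯ + Ar·ζr^n. In particular this sum vanishes for 1 ≤ n < r. -/
/-- The finite set of compositions of `n` into exactly `r` positive
integer parts, encoded as functions `Fin r → ℕ` with every value `≥ 1`
summing to `n`. -/
def comps (r n : ℕ) : Finset (Fin r → ℕ) :=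
  (Fintype.piFinset fun _ : Fin r => Finset.range (n + 1)).filter
    fun f => (∀ i, 1 ≤ f i) ∧ ∑ i, f i = n

theorem mem_comps {r n : ℕ} {f : Fin r → ℕ} :
    f ∈ comps r n ↔ (∀ i, 1 ≤ f i) ∧ ∑ i, f i = n := by
  simp only [comps, Finset.mem_filter, Fintype.mem_piFinset, Finset.mem_range,
    and_iff_right_iff_imp]
  rintro ⟨-, rfl⟩ i
  exact Nat.lt_succ_of_le (Finset.single_le_sum (fun _ _ => Nat.zero_le _) (Finset.mem_univ i))

theorem comps_eq_empty {r n : ℕ} (h : n < r) : comps r n = ∅ := by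
  refine Finset.eq_empty_of_forall_notMem fun f hf => ?_
  obtain ⟨h1, h2⟩ := mem_comps.1 hf
  have h3 : ∑ _i : Fin r, 1 ≤ ∑ i, f i := Finset.sum_le_sum fun i _ => h1 i
  simp at h3
  omega

theorem sum_comps_succ {R : Type*} [CommSemiring R] (r n : ℕ) (ζ : Fin (r + 1) → R) :
    ∑ f ∈ comps (r + 1) (n + 1), ∏ i, ζ i ^ f i =
      ∑ k ∈ Finset.range (n + 1),
        ζ 0 ^ (k + 1) * ∑ f ∈ comps r (n - k), ∏ i, ζ i.succ ^ f i := by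
  simp only [Finset.mul_sum]
  rw [Finset.sum_sigma']
  refine Finset.sum_bij' (fun f _ => ⟨f 0 - 1, Fin.tail f⟩)
    (fun p _ => Fin.cons (p.1 + 1) p.2) ?_ ?_ ?_ ?_ ?_
  · intro f hf
    obtain ⟨h1, h2⟩ := mem_comps.1 hf
    rw [Fin.sum_univ_succ] at h2
    have h0 := h1 0
    simp only [Finset.mem_sigma, Finset.mem_range, mem_comps]
    refine ⟨by omega, fun i => h1 i.succ, ?_⟩
    simp only [Fin.tail]
    omega
  · rintro ⟨k, f⟩ hp
    simp only [Finset.mem_sigma, Finset.mem_range, mem_comps] at hp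
    obtain ⟨hk, h1, h2⟩ := hp
    refine mem_comps.2 ⟨Fin.cases (by simp) (by simpa using h1), ?_⟩
    simp only [Fin.sum_univ_succ, Fin.cons_zero, Fin.cons_succ, h2]
    omega
  · intro f hf
    have h0 := (mem_comps.1 hf).1 0
    simp only [Nat.sub_add_cancel h0, Fin.cons_self_tail]
  · rintro ⟨k, f⟩ _
    simp
  · intro f hf
    have h0 := (mem_comps.1 hf).1 0
    simp only [Fin.prod_univ_succ, Nat.sub_add_cancel h0, Fin.tail]

theorem sum_pow_succ_mul_pow_sub {K : Type*} [Field K] {x y : K} (h : x ≠ y) (n : ℕ) :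
    ∑ k ∈ Finset.range n, x ^ (k + 1) * y ^ (n - k) =
      y / (x - y) * x ^ (n + 1) - x / (x - y) * y ^ (n + 1) := by
  have hxy : x - y ≠ 0 := sub_ne_zero.2 h
  induction n with
  | zero => simp; ring
  | succ n ih =>
    have step : ∑ k ∈ Finset.range n, x ^ (k + 1) * y ^ (n + 1 - k) =
        y * ∑ k ∈ Finset.range n, x ^ (k + 1) * y ^ (n - k) := by
      rw [Finset.mul_sum]
      refine Finset.sum_congr rfl fun k hk => ?_
      rw [Nat.succ_sub (Finset.mem_range.1 hk).le, pow_succ y]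
      ring
    rw [Finset.sum_range_succ, step, ih, Nat.add_sub_cancel_left]
    field_simp
    ring

theorem exists_sum_comps_eq_sum_mul_pow {K : Type*} [Field K] (r : ℕ) (ζ : Fin (r + 1) → K)
    (hζ : Function.Injective ζ) :
    ∃ A : Fin (r + 1) → K, ∀ n : ℕ,
      ∑ f ∈ comps (r + 1) (n + 1), ∏ i, ζ i ^ f i = ∑ j, A j * ζ j ^ (n + 1) := by
  induction r with
  | zero =>
    refine ⟨1, fun n => ?_⟩
    have : comps 1 (n + 1) = {fun _ => n + 1} := by
      ext f
      simp only [mem_comps, Finset.mem_singleton, funext_iff, Fin.forall_fin_one,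
        Fin.sum_univ_one]
      omega
    simp [this]
  | succ r ih =>
    obtain ⟨A, hA⟩ := ih (fun i => ζ i.succ) (hζ.comp (Fin.succ_injective _))
    refine ⟨Fin.cons (∑ j, A j * (ζ j.succ / (ζ 0 - ζ j.succ)))
      fun j => -(A j * (ζ 0 / (ζ 0 - ζ j.succ))), fun n => ?_⟩
    rw [sum_comps_succ, Finset.sum_range_succ, Nat.sub_self,
      comps_eq_empty (Nat.succ_pos r), Finset.sum_empty, mul_zero, add_zero]
    have inner : ∀ k ∈ Finset.range n,
        ζ 0 ^ (k + 1) * ∑ f ∈ comps (r + 1) (n - k), ∏ i, ζ i.succ ^ f i =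
          ∑ j, A j * (ζ 0 ^ (k + 1) * ζ j.succ ^ (n - k)) := by
      intro k hk
      obtain ⟨m, hm⟩ := Nat.exists_eq_succ_of_ne_zero
        (Nat.sub_ne_zero_of_lt (Finset.mem_range.1 hk))
      rw [hm, Nat.succ_eq_add_one, hA m, Finset.mul_sum]
      exact Finset.sum_congr rfl fun j _ => by ring
    rw [Finset.sum_congr rfl inner, Finset.sum_comm, Fin.sum_univ_succ (n := r + 1)]
    simp only [Fin.cons_zero, Fin.cons_succ]
    rw [Finset.sum_mul, ← Finset.sum_add_distrib]
    refine Finset.sum_congr rfl fun j _ => ?_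
    rw [← Finset.mul_sum, sum_pow_succ_mul_pow_sub (hζ.ne (Fin.succ_ne_zero j).symm)]
    ring

/-- For pairwise distinct `ζ1, …, ζr`, there are coefficients
`A1, …, Ar` such that for every `n ≥ 1` the sum over compositions of `n`
into `r` positive parts of `ζ1^{k1}⋯ζr^{kr}` equals `∑ j, Aj ζj^n`.
In particular the sum vanishes for `1 ≤ n < r`. -/
theorem composition_power_sum_repr
    (r : ℕ) (hr : 1 ≤ r) (ζ : Fin r → ℂ) (hζ : Function.Injective ζ) :
    (∃ A : Fin r → ℂ, ∀ n : ℕ, 1 ≤ n →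
      ∑ f ∈ comps r n, ∏ i, ζ i ^ f i = ∑ j, A j * ζ j ^ n) ∧
    (∀ n : ℕ, 1 ≤ n → n < r → ∑ f ∈ comps r n, ∏ i, ζ i ^ f i = 0) := by
  refine ⟨?_, fun n _ h => by rw [comps_eq_empty h, Finset.sum_empty]⟩
  obtain ⟨r, rfl⟩ := Nat.exists_eq_add_of_le' hr
  obtain ⟨A, hA⟩ := exists_sum_comps_eq_sum_mul_pow r ζ hζ
  refine ⟨A, fun n hn => ?_⟩
  obtain ⟨m, rfl⟩ := Nat.exists_eq_add_of_le' hn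
  exact hA m
end

section
/- Let r ≥ 1 and let ζ1, …, ζr be pairwise distinct complex numbers. Then for every integer n ≥ 1, the sum over all r-tuples (l1, …, lr) of integers with each li ≥ 1 and l1 + ⋯ + lr = n of the products ζ1^{l1−1}·ζ2^{l2−1}·⋯·ζr^{lr−1} equals the sum over j = 1, …, r of ζj^{n−1} divided by the product over all l ≠ j of (ζj − ζl). -/
/-- The power series `X / (1 - a X) = ∑_{k ≥ 1} a ^ (k - 1) X ^ k`. -/
noncomputable def shiftedGeom (a : ℂ) : PowerSeries ℂ :=
  PowerSeries.mk fun k => if k = 0 then 0 else a ^ (k - 1)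

theorem coeff_shiftedGeom (a : ℂ) {k : ℕ} (hk : 1 ≤ k) :
    PowerSeries.coeff k (shiftedGeom a) = a ^ (k - 1) := by
  rw [shiftedGeom, PowerSeries.coeff_mk, if_neg (by omega)]

theorem coeff_zero_shiftedGeom (a : ℂ) : PowerSeries.coeff 0 (shiftedGeom a) = 0 := by
  rw [shiftedGeom, PowerSeries.coeff_mk, if_pos rfl]

theorem shiftedGeom_mul_one_sub (a : ℂ) :
    shiftedGeom a * (1 - PowerSeries.C a * PowerSeries.X) = PowerSeries.X := by
  ext k
  rw [mul_sub, mul_one, mul_left_comm, map_sub, PowerSeries.coeff_C_mul, PowerSeries.coeff_X]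
  rcases k with _ | _ | k
  · simp [coeff_zero_shiftedGeom]
  · rw [PowerSeries.coeff_succ_mul_X]
    simp [coeff_zero_shiftedGeom, coeff_shiftedGeom]
  · rw [PowerSeries.coeff_succ_mul_X, coeff_shiftedGeom a (by omega),
      coeff_shiftedGeom a (by omega)]
    simp [pow_succ']

theorem shiftedGeom_mul_shiftedGeom {a b : ℂ} (hab : a ≠ b) :
    shiftedGeom a * shiftedGeom b =
      PowerSeries.C (a - b)⁻¹ * (shiftedGeom a - shiftedGeom b) := by
  have hX : (PowerSeries.X : PowerSeries ℂ) ≠ 0 := PowerSeries.X_ne_zero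
  have hC : PowerSeries.C (a - b)⁻¹ * (PowerSeries.C a - PowerSeries.C b) =
      (1 : PowerSeries ℂ) := by
    rw [← map_sub, ← map_mul, inv_mul_cancel₀ (sub_ne_zero.mpr hab), map_one]
  have ha := shiftedGeom_mul_one_sub a
  have hb := shiftedGeom_mul_one_sub b
  apply mul_left_cancel₀ hX
  linear_combination
    (PowerSeries.C (a - b)⁻¹ * shiftedGeom a) * hb -
    (PowerSeries.C (a - b)⁻¹ * shiftedGeom b) * ha -
    (PowerSeries.X * shiftedGeom a * shiftedGeom b) * hC

theorem prod_shiftedGeom {ι : Type*} [DecidableEq ι] (v : ι → ℂ) (s : Finset ι)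
    (hs : s.Nonempty) (hv : Set.InjOn v s) :
    ∏ i ∈ s, shiftedGeom (v i) =
      ∑ j ∈ s, PowerSeries.C (Lagrange.nodalWeight s v j) * shiftedGeom (v j) := by
  induction hs using Finset.Nonempty.cons_induction with
  | singleton a => simp [Lagrange.nodalWeight]
  | cons a s ha hs ih =>
    have hne : ∀ j ∈ s, v a ≠ v j := fun j hj h =>
      ha (hv (by simp) (by simp [hj]) h ▸ hj)
    have hvs : Set.InjOn v s := hv.mono (by simp)
    have hweight : ∀ j ∈ s, Lagrange.nodalWeight (Finset.cons a s ha) v j =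
        (v j - v a)⁻¹ * Lagrange.nodalWeight s v j := by
      intro j hj
      have hja : a ≠ j := fun h => ha (h ▸ hj)
      rw [Lagrange.nodalWeight, Lagrange.nodalWeight, Finset.cons_eq_insert,
        Finset.erase_insert_of_ne hja, Finset.prod_insert (by simp [ha])]
    have hweight' : Lagrange.nodalWeight (Finset.cons a s ha) v a =
        ∑ j ∈ s, Lagrange.nodalWeight s v j * (v a - v j)⁻¹ := by
      have h1 := Lagrange.eval_interpolate_not_at_node (s := s) (v := v) (x := v a) 1 hne
      rw [Lagrange.interpolate_one hvs hs, Lagrange.eval_nodal] at h1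
      simp only [Polynomial.eval_one, Pi.one_apply, mul_one] at h1
      rw [Lagrange.nodalWeight, Finset.cons_eq_insert, Finset.erase_insert ha,
        Finset.prod_inv_distrib]
      exact inv_eq_of_mul_eq_one_right h1.symm
    rw [Finset.prod_cons, Finset.sum_cons, ih hvs, hweight', map_sum, Finset.mul_sum,
      Finset.sum_mul, ← Finset.sum_add_distrib]
    refine Finset.sum_congr rfl fun j hj => ?_
    rw [hweight j hj, mul_left_comm, shiftedGeom_mul_shiftedGeom (hne j hj),
      ← neg_sub (v a) (v j), inv_neg, map_mul, map_mul, map_neg]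
    ring

theorem sum_comps_eq_coeff_prod (r n : ℕ) (ζ : Fin r → ℂ) :
    ∑ f ∈ comps r n, ∏ i, ζ i ^ (f i - 1) =
      PowerSeries.coeff n (∏ i, shiftedGeom (ζ i)) := by
  rw [PowerSeries.coeff_prod]
  refine Finset.sum_of_injOn (Finsupp.equivFunOnFinite.symm)
    (Equiv.injective _).injOn ?_ ?_ ?_
  · intro f hf
    simpa using (mem_comps.mp hf).2
  · intro l hl hl'
    by_contra hne
    refine hl' ⟨l, mem_comps.mpr ⟨fun i => ?_, ?_⟩, by simp⟩
    · by_contra hi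
      refine hne (Finset.prod_eq_zero (Finset.mem_univ i) ?_)
      rw [show l i = 0 by omega, coeff_zero_shiftedGeom]
    · simpa using hl
  · intro f hf
    refine Finset.prod_congr rfl fun i _ => ?_
    exact (coeff_shiftedGeom _ ((mem_comps.mp hf).1 i)).symm

/-- Rational-function representation: for pairwise distinct
`ζ1, …, ζr` and `n ≥ 1`, the sum over compositions of `n` into `r`
positive parts of `ζ1^{l1−1}⋯ζr^{lr−1}` equals
`∑ j, ζj^{n−1} / ∏_{l ≠ j} (ζj − ζl)`. -/
theorem composition_sum_partial_fractions
    (r : ℕ) (hr : 1 ≤ r) (ζ : Fin r → ℂ) (hζ : Function.Injective ζ)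
    (n : ℕ) (hn : 1 ≤ n) :
    ∑ f ∈ comps r n, ∏ i, ζ i ^ (f i - 1) =
      ∑ j, ζ j ^ (n - 1) / ∏ l ∈ Finset.univ.erase j, (ζ j - ζ l) := by
  have : Nonempty (Fin r) := ⟨⟨0, hr⟩⟩
  rw [sum_comps_eq_coeff_prod,
    prod_shiftedGeom ζ Finset.univ Finset.univ_nonempty hζ.injOn, map_sum]
  refine Finset.sum_congr rfl fun j _ => ?_
  rw [PowerSeries.coeff_C_mul, coeff_shiftedGeom _ hn, Lagrange.nodalWeight,
    Finset.prod_inv_distrib, div_eq_mul_inv, mul_comm]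
end
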